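/- arXiv:0711.5008 — 4 statements merged into one kernel-verified Lean document; each statement's English description precedes it below -/
import Mathlib

section
/- Let (X, μ) be a measure space, g : X → ℝ a nonnegative measurable function, R > 0 a real number, k ≥ 1 an integer, and θ a real number with 0 < θ < 10/3. Then ∫_X g(x)^θ · 𝟙{g(x) ≥ R·(1 − 2^{-k})} dμ(x) ≤ 2^{θ+1} · 2^{10k/3} · R^{θ − 10/3} · ∫_X ((g(x) − R·(1 − 2^{-(k-1)}))₊)^{10/3} dμ(x). -/
open MeasureTheory

/-- Raising the index: estimate of `∫ g^θ` over the level set by the previous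
level set energy. -/
theorem stmt6 {X : Type*} [MeasurableSpace X] (μ : Measure X)
    (g : X → ℝ) (hg : Measurable g) (hg0 : ∀ x, 0 ≤ g x)
    (R : ℝ) (hR : 0 < R) (k : ℕ) (hk : 1 ≤ k) (θ : ℝ) (hθ0 : 0 < θ) (hθ : θ < 10/3) :
    ∫⁻ x in {x | R * (1 - 1 / 2 ^ k) ≤ g x}, ENNReal.ofReal (g x ^ θ) ∂μ ≤
      ENNReal.ofReal (2 ^ (θ + 1) * 2 ^ (10 * (k : ℝ) / 3) * R ^ (θ - 10/3)) *
        ∫⁻ x, ENNReal.ofReal ((max (g x - R * (1 - 1 / 2 ^ (k - 1))) 0) ^ (10/3 : ℝ)) ∂μ := by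
  have hS : MeasurableSet {x | R * (1 - 1 / 2 ^ k) ≤ g x} := measurableSet_le measurable_const hg
  rw [← lintegral_const_mul' _ _ ENNReal.ofReal_ne_top]
  refine le_trans (setLIntegral_mono' hS ?_) (setLIntegral_le_lintegral _ _)
  intro x hx
  rw [← ENNReal.ofReal_mul (by positivity)]
  apply ENNReal.ofReal_le_ofReal
  have hx' : R * (1 - 1 / 2 ^ k) ≤ g x := hx
  obtain ⟨m, rfl⟩ : ∃ m, k = m + 1 := ⟨k - 1, by omega⟩
  rw [Nat.add_sub_cancel]
  set d : ℝ := g x - R * (1 - 1 / 2 ^ m) with hd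
  have hp : (1 : ℝ) ≤ 2 ^ m := one_le_pow₀ (by norm_num)
  have hK : (2 : ℝ) ^ (m + 1) = 2 * 2 ^ m := by ring
  have hKr : (2 : ℝ) ^ (10 * ((m + 1 : ℕ) : ℝ) / 3) = ((2 : ℝ) ^ (m + 1)) ^ (10 / 3 : ℝ) := by
    rw [← Real.rpow_natCast, ← Real.rpow_mul (by norm_num)]
    congr 1
    ring
  rw [hKr]
  rw [hK] at hx' ⊢
  set p : ℝ := 2 ^ m with hpdef
  have hp0 : 0 < p := by linarith
  have hdp : d * p = g x * p - R * p + R := by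
    rw [hd]; field_simp; ring
  have hx2 : 2 * p * R - R ≤ g x * (2 * p) := by
    have := mul_le_mul_of_nonneg_right hx' (by positivity : (0 : ℝ) ≤ 2 * p)
    have h2 : R * (1 - 1 / (2 * p)) * (2 * p) = 2 * p * R - R := by field_simp
    linarith
  have hRd : R ≤ 2 * p * d := by nlinarith
  have hd0 : 0 < d := by
    by_contra h
    push Not at h
    nlinarith
  have hgd : g x ≤ 2 * p * d := by nlinarith
  rw [max_eq_left hd0.le]
  set v : ℝ := 2 * p * d / R with hv
  have hv1 : 1 ≤ v := by rw [hv, le_div_iff₀ hR]; linarith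
  have hv0 : 0 ≤ v := by linarith
  have hRv : 2 * p * d = R * v := by rw [hv]; field_simp
  have h1 : g x ^ θ ≤ R ^ θ * v ^ (10 / 3 : ℝ) := by
    calc g x ^ θ ≤ (R * v) ^ θ := Real.rpow_le_rpow (hg0 x) (hRv ▸ hgd) hθ0.le
      _ = R ^ θ * v ^ θ := Real.mul_rpow hR.le hv0
      _ ≤ _ := by
        gcongr
  have h2 : v ^ (10 / 3 : ℝ) = (2 * p) ^ (10 / 3 : ℝ) * d ^ (10 / 3 : ℝ) / R ^ (10 / 3 : ℝ) := by
    rw [hv, Real.div_rpow (by positivity) hR.le, Real.mul_rpow (by positivity) hd0.le]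
  have h3 : (1 : ℝ) ≤ 2 ^ (θ + 1) := Real.one_le_rpow (by norm_num) (by linarith)
  have h4 : 0 ≤ R ^ θ * v ^ (10 / 3 : ℝ) := by positivity
  calc g x ^ θ ≤ 1 * (R ^ θ * v ^ (10 / 3 : ℝ)) := by linarith
    _ ≤ 2 ^ (θ + 1) * (R ^ θ * v ^ (10 / 3 : ℝ)) := mul_le_mul_of_nonneg_right h3 h4
    _ = _ := by
      rw [h2, Real.rpow_sub hR]
      ring
end

section
/- Let β > 3/2 be a real number. Then there exists R₀ > 1 such that for every real R > R₀, every integer k ≥ 1, and all real numbers a, g, G with a > 0 and 0 ≤ g ≤ G, the following holds: setting c = R·(1 − 2^{-k}), C = R^β·(1 − 2^{-k}), v = (a − c)₊, w = (a − C)₊, and defining d ≥ 0 and D ≥ 0 by d² = (c/a)·𝟙{a ≥ c}·g² + (v/a)·G² and D² = (C/a)·𝟙{a ≥ C}·g² + (w/a)·G², one has D² ≤ 5·d² (and hence D ≤ √5·d). -/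
/-- Pointwise comparison `D_k ≤ √5 · d_k` between the quantities associated with
the truncations at heights `R(1 - 2^{-k})` and `R^β(1 - 2^{-k})`. -/
theorem stmt8 (β : ℝ) (hβ : 3/2 < β) :
    ∃ R₀ : ℝ, 1 < R₀ ∧ ∀ R : ℝ, R₀ < R → ∀ k : ℕ, 1 ≤ k →
      ∀ a g G d D : ℝ, 0 < a → 0 ≤ g → g ≤ G → 0 ≤ d → 0 ≤ D →
        d ^ 2 = (R * (1 - 1 / 2 ^ k) / a) * (if R * (1 - 1 / 2 ^ k) ≤ a then (1 : ℝ) else 0) * g ^ 2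
                  + (max (a - R * (1 - 1 / 2 ^ k)) 0 / a) * G ^ 2 →
        D ^ 2 = (R ^ β * (1 - 1 / 2 ^ k) / a) * (if R ^ β * (1 - 1 / 2 ^ k) ≤ a then (1 : ℝ) else 0) * g ^ 2
                  + (max (a - R ^ β * (1 - 1 / 2 ^ k)) 0 / a) * G ^ 2 →
        D ^ 2 ≤ 5 * d ^ 2 ∧ D ≤ Real.sqrt 5 * d := by
  refine ⟨2, by norm_num, ?_⟩
  intro R hR k hk a g G d D ha hg hgG hd hD h1 h2
  have hs : (0 : ℝ) ≤ 1 - 1 / 2 ^ k := by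
    have : (1 : ℝ) / 2 ^ k ≤ 1 := by
      rw [div_le_one (by positivity)]
      exact one_le_pow₀ (by norm_num)
    linarith
  have hRβ : R ≤ R ^ β := by
    have := Real.rpow_le_rpow_of_exponent_le (x := R) (by linarith) (show (1 : ℝ) ≤ β by linarith)
    simpa using this
  have hcC : R * (1 - 1 / 2 ^ k) ≤ R ^ β * (1 - 1 / 2 ^ k) := mul_le_mul_of_nonneg_right hRβ hs
  have hgG2 : g ^ 2 ≤ G ^ 2 := pow_le_pow_left₀ hg hgG 2
  generalize R * (1 - 1 / 2 ^ k) = c at *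
  generalize R ^ β * (1 - 1 / 2 ^ k) = C at *
  have key : D ^ 2 ≤ d ^ 2 := by
    by_cases hC : C ≤ a
    · rw [if_pos hC, max_eq_left (by linarith)] at h2
      rw [if_pos (hcC.trans hC), max_eq_left (by linarith)] at h1
      have e : d ^ 2 - D ^ 2 = (C - c) * (G ^ 2 - g ^ 2) / a := by
        rw [h1, h2]; ring
      have : 0 ≤ (C - c) * (G ^ 2 - g ^ 2) / a :=
        div_nonneg (mul_nonneg (by linarith) (by linarith)) ha.le
      linarith
    · rw [if_neg hC, max_eq_right (by linarith)] at h2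
      have : D ^ 2 = 0 := by rw [h2]; ring
      rw [this]; positivity
  have key5 : D ^ 2 ≤ 5 * d ^ 2 := by nlinarith [sq_nonneg d]
  refine ⟨key5, ?_⟩
  have h5 : D ^ 2 ≤ (Real.sqrt 5 * d) ^ 2 := by
    rw [mul_pow, Real.sq_sqrt (by norm_num)]; exact key5
  exact (pow_le_pow_iff_left₀ hD (by positivity) (by norm_num)).1 h5
end

section
/- Let B ⊆ ℝ³ be a measurable set of finite Lebesgue measure, let α, K, N be positive real numbers, and let p be a real number with 1 < p < 5/4. Let f : ℝ³ → ℝ be measurable with ∫_B exp(α·|f(x)|/N) dx ≤ K, and let μ : ℝ³ → [0, ∞) be measurable with μ integrable on B and μ·log⁺μ integrable on B. Then ∫_B μ(x)·|f(x)| dx ≤ (2p/(α(p−1))) · (1 + K^{1−1/p}) · N · ((∫_B μ(x) dx)^{1/p} + ∫_B μ(x)·log⁺(μ(x)) dx). -/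
open MeasureTheory

theorem stmt9_aux (m g p q : ℝ) (hm : 0 ≤ m) (hpq : p.HolderConjugate q) :
    m * g ≤ m * max (Real.log m) 0 + q * (m ^ (1/p) * Real.exp g ^ (1/q)) := by
  have hq : 0 < q := hpq.symm.pos
  have hp : 0 < p := hpq.pos
  rcases hm.eq_or_lt with h | h
  · subst h
    have : 0 ≤ q * ((0:ℝ) ^ (1/p) * Real.exp g ^ (1/q)) := by positivity
    simpa using this
  · have e1 : m ^ (1/p) * Real.exp g ^ (1/q) = m * Real.exp ((g - Real.log m) / q) := by
      have h1 : (1:ℝ)/p = 1 - 1/q := by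
        have := hpq.inv_add_inv_eq_one
        simp only [one_div]; linarith
      rw [h1, ← Real.exp_mul, Real.rpow_def_of_pos h, ← Real.exp_add]
      nth_rewrite 2 [← Real.exp_log h]
      rw [← Real.exp_add]
      congr 1
      field_simp
      ring
    rw [e1]
    have h2 := Real.add_one_le_exp ((g - Real.log m) / q)
    have h3 : g - Real.log m ≤ q * Real.exp ((g - Real.log m) / q) := by
      have : q * ((g - Real.log m) / q) = g - Real.log m := by field_simp
      nlinarith
    have h4 := le_max_left (Real.log m) 0
    have h5 : m * g ≤ m * (max (Real.log m) 0 + q * Real.exp ((g - Real.log m) / q)) :=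
      mul_le_mul_of_nonneg_left (by linarith) hm
    linarith

/-- John–Nirenberg type weighted estimate: `∫_B μ|f|` is controlled by
`(∫_B μ)^{1/p}` and `∫_B μ log⁺ μ`. -/
theorem stmt9 (B : Set (EuclideanSpace ℝ (Fin 3))) (hB : MeasurableSet B)
    (hBfin : volume B < ⊤)
    (α K N : ℝ) (hα : 0 < α) (hK : 0 < K) (hN : 0 < N)
    (p : ℝ) (hp1 : 1 < p) (hp2 : p < 5/4)
    (f : EuclideanSpace ℝ (Fin 3) → ℝ) (hf : Measurable f)
    (hexp : ∫⁻ x in B, ENNReal.ofReal (Real.exp (α * |f x| / N)) ≤ ENNReal.ofReal K)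
    (μ : EuclideanSpace ℝ (Fin 3) → ℝ) (hμmeas : Measurable μ) (hμ0 : ∀ x, 0 ≤ μ x)
    (hμint : IntegrableOn μ B)
    (hμlog : IntegrableOn (fun x => μ x * max (Real.log (μ x)) 0) B) :
    ∫⁻ x in B, ENNReal.ofReal (μ x * |f x|) ≤
      ENNReal.ofReal ((2 * p / (α * (p - 1))) * (1 + K ^ (1 - 1/p)) * N *
        ((∫ x in B, μ x) ^ (1/p) + ∫ x in B, μ x * max (Real.log (μ x)) 0)) := by
  obtain ⟨q, hqdef⟩ : ∃ q, q = p / (p - 1) := ⟨_, rfl⟩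
  have hpq : p.HolderConjugate q := by
    rw [hqdef]; exact Real.HolderConjugate.conjExponent hp1
  have hp : 0 < p := hpq.pos
  have hq : 0 < q := hpq.symm.pos
  have hq1 : 1 < q := hpq.symm.lt
  have hqi : 1 - 1/p = 1/q := by
    have := hpq.inv_add_inv_eq_one
    simp only [one_div]; linarith
  have hM : 0 ≤ ∫ x in B, μ x := integral_nonneg hμ0
  have hlog0 : ∀ x, 0 ≤ μ x * max (Real.log (μ x)) 0 :=
    fun x => mul_nonneg (hμ0 x) (le_max_right _ _)
  have hL : 0 ≤ ∫ x in B, μ x * max (Real.log (μ x)) 0 := integral_nonneg hlog0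
  have hMl : ∫⁻ x in B, ENNReal.ofReal (μ x) = ENNReal.ofReal (∫ x in B, μ x) :=
    (ofReal_integral_eq_lintegral_ofReal hμint (Filter.Eventually.of_forall hμ0)).symm
  have hLl : ∫⁻ x in B, ENNReal.ofReal (μ x * max (Real.log (μ x)) 0)
      = ENNReal.ofReal (∫ x in B, μ x * max (Real.log (μ x)) 0) :=
    (ofReal_integral_eq_lintegral_ofReal hμlog (Filter.Eventually.of_forall hlog0)).symm
  set M := ∫ x in B, μ x with hMdef
  set L := ∫ x in B, μ x * max (Real.log (μ x)) 0 with hLdef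
  set u : EuclideanSpace ℝ (Fin 3) → ENNReal := fun x => ENNReal.ofReal (μ x) ^ (1/p) with hu
  set v : EuclideanSpace ℝ (Fin 3) → ENNReal :=
    fun x => ENNReal.ofReal (Real.exp (α * |f x| / N)) ^ (1/q) with hv
  have hum : Measurable u := by fun_prop
  have hvm : Measurable v := by fun_prop
  have hold : ∫⁻ x in B, u x * v x ≤ ENNReal.ofReal (M ^ (1/p) * K ^ (1/q)) := by
    have h := ENNReal.lintegral_mul_le_Lp_mul_Lq (volume.restrict B) hpq
      hum.aemeasurable hvm.aemeasurable
    have e1 : ∀ x, u x ^ p = ENNReal.ofReal (μ x) := fun x => by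
      simp only [hu]
      rw [← ENNReal.rpow_mul, one_div_mul_cancel hp.ne', ENNReal.rpow_one]
    have e2 : ∀ x, v x ^ q = ENNReal.ofReal (Real.exp (α * |f x| / N)) := fun x => by
      simp only [hv]
      rw [← ENNReal.rpow_mul, one_div_mul_cancel hq.ne', ENNReal.rpow_one]
    simp only [e1, e2, hMl] at h
    refine h.trans ?_
    rw [ENNReal.ofReal_mul (by positivity),
      ← ENNReal.ofReal_rpow_of_nonneg hM (by positivity),
      ← ENNReal.ofReal_rpow_of_nonneg hK.le (by positivity)]
    gcongr
  have pw : ∀ x, ENNReal.ofReal (μ x * |f x|) ≤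
      ENNReal.ofReal (N/α) * (ENNReal.ofReal (μ x * max (Real.log (μ x)) 0)
        + ENNReal.ofReal q * (u x * v x)) := fun x => by
    have h := stmt9_aux (μ x) (α * |f x| / N) p q (hμ0 x) hpq
    simp only [hu, hv]
    have hx := hμ0 x
    have hl := hlog0 x
    rw [ENNReal.ofReal_rpow_of_nonneg hx (by positivity),
      ENNReal.ofReal_rpow_of_nonneg (Real.exp_pos _).le (by positivity),
      ← ENNReal.ofReal_mul (by positivity), ← ENNReal.ofReal_mul (by positivity),
      ← ENNReal.ofReal_add hl (by positivity), ← ENNReal.ofReal_mul (by positivity)]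
    apply ENNReal.ofReal_le_ofReal
    calc μ x * |f x| = N/α * (μ x * (α * |f x| / N)) := by field_simp
      _ ≤ _ := mul_le_mul_of_nonneg_left h (by positivity)
  calc ∫⁻ x in B, ENNReal.ofReal (μ x * |f x|)
      ≤ ∫⁻ x in B, ENNReal.ofReal (N/α) * (ENNReal.ofReal (μ x * max (Real.log (μ x)) 0)
        + ENNReal.ofReal q * (u x * v x)) := lintegral_mono pw
    _ = ENNReal.ofReal (N/α) * (ENNReal.ofReal L
        + ENNReal.ofReal q * ∫⁻ x in B, u x * v x) := by
      rw [lintegral_const_mul _ (by fun_prop), lintegral_add_left (by fun_prop),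
        lintegral_const_mul _ (by fun_prop), hLl]
    _ ≤ ENNReal.ofReal (N/α) * (ENNReal.ofReal L
        + ENNReal.ofReal q * ENNReal.ofReal (M ^ (1/p) * K ^ (1/q))) := by gcongr
    _ = ENNReal.ofReal (N/α * (L + q * (M ^ (1/p) * K ^ (1/q)))) := by
      rw [← ENNReal.ofReal_mul (by positivity), ← ENNReal.ofReal_add hL (by positivity),
        ← ENNReal.ofReal_mul (by positivity)]
    _ ≤ _ := by
      apply ENNReal.ofReal_le_ofReal
      rw [hqi]
      have hp' : 0 < p - 1 := by linarith
      have e : 2 * p / (α * (p - 1)) = 2 * q / α := by rw [hqdef]; field_simp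
      rw [e]
      have hA : 0 ≤ M ^ (1/p) := by positivity
      have hC : 0 ≤ K ^ (1/q) := by positivity
      generalize M ^ (1/p) = A at *
      generalize K ^ (1/q) = C at *
      have : 2 * q / α * (1 + C) * N * (A + L) = N/α * (2 * q * (1 + C) * (A + L)) := by
        field_simp
      rw [this]
      apply mul_le_mul_of_nonneg_left _ (by positivity)
      have h1 : 0 ≤ q * (A * C) := by positivity
      have h2 : 0 ≤ q * (C * L) := by positivity
      have h3 : 0 ≤ q * A := by positivity
      have h4 : 0 ≤ (q - 1) * L := mul_nonneg (by linarith) hL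
      nlinarith
end

section
/- Let c ≥ 0 be a real number and let u : ℝ³ → ℝ³ be differentiable at a point x ∈ ℝ³ with ‖u(x)‖ > c. Set a = ‖u(x)‖, v = a − c, let G be the operator norm of the Fréchet derivative of u at x, let g = ‖∇‖u‖(x)‖ be the norm of the gradient at x of the map y ↦ ‖u(y)‖, and let d = ((c/a)·g² + (v/a)·G²)^{1/2}. Then the map y ↦ ((‖u(y)‖ − c)₊ / ‖u(y)‖)·u(y) is differentiable at x and the operator norm of its Fréchet derivative at x is at most 3d. -/
/-- The pointwise bound `|∇((|u|−c)₊ u/|u|)| ≤ 3 d` at a point where `|u| > c`. -/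
theorem stmt14 (c : ℝ) (hc : 0 ≤ c)
    (u : EuclideanSpace ℝ (Fin 3) → EuclideanSpace ℝ (Fin 3))
    (x : EuclideanSpace ℝ (Fin 3)) (hu : DifferentiableAt ℝ u x) (hux : c < ‖u x‖) :
    DifferentiableAt ℝ (fun y => ((max (‖u y‖ - c) 0) / ‖u y‖) • u y) x ∧
    ‖fderiv ℝ (fun y => ((max (‖u y‖ - c) 0) / ‖u y‖) • u y) x‖ ≤
      3 * Real.sqrt ((c / ‖u x‖) * ‖gradient (fun y => ‖u y‖) x‖ ^ 2 +
        ((‖u x‖ - c) / ‖u x‖) * ‖fderiv ℝ u x‖ ^ 2) := by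
  have ha : 0 < ‖u x‖ := lt_of_le_of_lt hc hux
  have hN : DifferentiableAt ℝ (fun y => ‖u y‖) x := hu.norm ℝ (norm_pos_iff.mp ha)
  have hg : ‖gradient (fun y => ‖u y‖) x‖ = ‖fderiv ℝ (fun y => ‖u y‖) x‖ := by
    simp [gradient]
  rw [hg]
  have hNd := hN.hasFDerivAt
  have hud := hu.hasFDerivAt
  set N := fderiv ℝ (fun y => ‖u y‖) x
  set A := fderiv ℝ u x
  have hφ : HasFDerivAt (fun y => 1 - c * ‖u y‖⁻¹) ((c / ‖u x‖ ^ 2) • N) x := by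
    have h1 : HasDerivAt (fun t : ℝ => 1 - c * t⁻¹) (c / ‖u x‖ ^ 2) ‖u x‖ := by
      have := ((hasDerivAt_inv ha.ne').const_mul c).const_sub 1
      refine HasDerivAt.congr_deriv this ?_
      field_simp
    exact HasDerivAt.comp_hasFDerivAt (f := fun y => ‖u y‖) x h1 hNd
  have hF := hφ.smul hud
  have hev : (fun y => ((max (‖u y‖ - c) 0) / ‖u y‖) • u y) =ᶠ[nhds x]
      (fun y => (1 - c * ‖u y‖⁻¹) • u y) := by
    filter_upwards [hN.continuousAt.eventually (lt_mem_nhds hux)] with y hy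
    have : 0 < ‖u y‖ := lt_of_le_of_lt hc hy
    rw [max_eq_left (by linarith)]
    congr 1
    field_simp
  have hF' := hF.congr_of_eventuallyEq hev
  refine ⟨hF'.differentiableAt, ?_⟩
  rw [hF'.fderiv]
  set a := ‖u x‖ with hadef
  set p := c / a with hp
  have hp0 : 0 ≤ p := by positivity
  have hp1 : p ≤ 1 := (div_le_one ha).2 hux.le
  have hq : (a - c) / a = 1 - p := by rw [hp]; field_simp
  have hq' : 1 - c * a⁻¹ = 1 - p := by rw [hp]; field_simp
  rw [hq, hq']
  have hb : ‖(1 - p) • A + ((c / a ^ 2) • N).smulRight (u x)‖ ≤ (1 - p) * ‖A‖ + p * ‖N‖ := by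
    refine (norm_add_le _ _).trans ?_
    rw [norm_smul, ContinuousLinearMap.norm_smulRight_apply, norm_smul, ← hadef,
      Real.norm_of_nonneg (by linarith : 0 ≤ 1 - p), Real.norm_of_nonneg (by positivity)]
    apply le_of_eq
    rw [hp]
    field_simp
  refine hb.trans ?_
  have hs : (1 - p) * ‖A‖ + p * ‖N‖ ≤ Real.sqrt (p * ‖N‖ ^ 2 + (1 - p) * ‖A‖ ^ 2) := by
    apply Real.le_sqrt_of_sq_le
    nlinarith [mul_nonneg (mul_nonneg hp0 (sub_nonneg.2 hp1)) (sq_nonneg (‖A‖ - ‖N‖))]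
  linarith [Real.sqrt_nonneg (p * ‖N‖ ^ 2 + (1 - p) * ‖A‖ ^ 2)]
end
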